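/- Let φ be a conformal biderivation of the loop W(a,b) Lie conformal algebra CLW(a,b). Then φ_λ(G_i, G_j) = 0 for all i, j ∈ Z. -/

import Mathlib

/- Framework: a Lie conformal algebra over ℂ is a ℂ[∂]-module `R` (given by a ℂ-module
with a ℂ-linear operator `D` for the action of `∂`) with a λ-bracket `B : R → R → R[λ]`.
We model `R[λ]` as `ℕ →₀ R` (coefficient of `λ^n` at index `n`) and `R[λ,μ,γ]` as an
iterated Finsupp.  Substitutions of the bracket variable are implemented by evaluating
the polynomial at a commuting operator (e.g. multiplication by `λ`, by `λ+μ`, or by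
`-∂-λ`), and brackets/biderivations are extended to polynomial-valued arguments by
ℂ[λ,μ,γ]-bilinearity. -/

namespace ConfBider

variable {R : Type} [AddCommGroup R] [Module ℂ R]

/-- `R[λ]`. -/
abbrev Pol1 (R : Type) [AddCommGroup R] : Type := ℕ →₀ R

/-- `R[λ,μ,γ]`: index `a` is the exponent of `λ`, then `μ`, then `γ`. -/
abbrev Pol3 (R : Type) [AddCommGroup R] : Type := ℕ →₀ (ℕ →₀ (ℕ →₀ R))

/-- Multiplication by the variable on `R[λ]`. -/
noncomputable def shift1 : Pol1 R → Pol1 R := Finsupp.mapDomain (· + 1)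

/-- The action of `∂` on coefficients of `R[λ]`. -/
noncomputable def D1 (D : R →ₗ[ℂ] R) : Pol1 R → Pol1 R := Finsupp.mapRange D (map_zero D)

/-- The operator "multiplication by `-∂-λ`" on `R[λ]`. -/
noncomputable def subNeg (D : R →ₗ[ℂ] R) : Pol1 R → Pol1 R := fun z => -(D1 D z) - shift1 z

/-- Evaluation of `f ∈ R[ν]` at the operator `e` (substitution `ν ↦ e`), inside `R[λ]`. -/
noncomputable def ev1 (f : Pol1 R) (e : Pol1 R → Pol1 R) : Pol1 R :=
  f.sum fun n r => e^[n] (Finsupp.single 0 r)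

/-- Constants `R → R[λ,μ,γ]`. -/
noncomputable def iota3 : R → Pol3 R := fun r => Finsupp.single 0 (Finsupp.single 0 (Finsupp.single 0 r))

/-- Multiplication by `λ` on `R[λ,μ,γ]`. -/
noncomputable def Xl : Pol3 R → Pol3 R := Finsupp.mapDomain (· + 1)

/-- Multiplication by `μ` on `R[λ,μ,γ]`. -/
noncomputable def Xm : Pol3 R → Pol3 R :=
  Finsupp.mapRange (Finsupp.mapDomain (· + 1)) Finsupp.mapDomain_zero

/-- Multiplication by `γ` on `R[λ,μ,γ]`. -/
noncomputable def Xg : Pol3 R → Pol3 R :=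
  Finsupp.mapRange (Finsupp.mapRange (Finsupp.mapDomain (· + 1)) Finsupp.mapDomain_zero)
    Finsupp.mapRange_zero

/-- Multiplication by `λ+μ` on `R[λ,μ,γ]`. -/
noncomputable def eLM : Pol3 R → Pol3 R := fun z => Xl z + Xm z

/-- Multiplication by `μ+γ` on `R[λ,μ,γ]`. -/
noncomputable def eMG : Pol3 R → Pol3 R := fun z => Xm z + Xg z

/-- Evaluation of `f ∈ R[ν]` at the operator `e` (substitution `ν ↦ e`), in `R[λ,μ,γ]`. -/
noncomputable def ev (f : Pol1 R) (e : Pol3 R → Pol3 R) : Pol3 R := f.sum fun n r => e^[n] (iota3 r)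

/-- Extension of an `R`-argument operation `F` to a polynomial argument in `R[λ,μ,γ]`,
by ℂ[λ,μ,γ]-linearity. -/
noncomputable def lift3 (F : R → Pol3 R) : Pol3 R → Pol3 R := fun w =>
  w.sum fun a fa => fa.sum fun b fb => fb.sum fun c r => Xl^[a] (Xm^[b] (Xg^[c] (F r)))

/-- `φ : R × R → R[λ]` is a conformal bilinear map: ℂ-bilinear with
`φ_λ(∂x,y) = -λ φ_λ(x,y)` and `φ_λ(x,∂y) = (∂+λ) φ_λ(x,y)`. -/
structure IsConfBilinear (D : R →ₗ[ℂ] R) (φ : R → R → Pol1 R) : Prop where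
  add_left : ∀ x x' y, φ (x + x') y = φ x y + φ x' y
  add_right : ∀ x y y', φ x (y + y') = φ x y + φ x y'
  smul_left : ∀ (c : ℂ) x y, φ (c • x) y = c • φ x y
  smul_right : ∀ (c : ℂ) x y, φ x (c • y) = c • φ x y
  d_left : ∀ x y, φ (D x) y = -(shift1 (φ x y))
  d_right : ∀ x y, φ x (D y) = D1 D (φ x y) + shift1 (φ x y)

/-- Skew-symmetry `φ_λ(x,y) = -φ_{-∂-λ}(y,x)`. -/
noncomputable def IsSkew (D : R →ₗ[ℂ] R) (φ : R → R → Pol1 R) : Prop :=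
  ∀ x y, φ x y = -(ev1 (φ y x) (subNeg D))

/-- A Lie conformal algebra structure: conformal sesquilinearity, skew-symmetry and
the Jacobi identity `[x_λ[y_μ z]] = [[x_λ y]_{λ+μ} z] + [y_μ[x_λ z]]`. -/
structure IsLieConformal (D : R →ₗ[ℂ] R) (B : R → R → Pol1 R) : Prop where
  bilin : IsConfBilinear D B
  skew : IsSkew D B
  jacobi : ∀ x y z,
    lift3 (fun r => ev (B x r) Xl) (ev (B y z) Xm)
      = lift3 (fun r => ev (B r z) eLM) (ev (B x y) Xl)
        + lift3 (fun r => ev (B y r) Xm) (ev (B x z) Xl)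

/-- A conformal biderivation of a Lie conformal algebra `(R, D, B)`: a skew-symmetric
conformal bilinear map `φ` with `φ_λ(x,[y_μ z]) = [(φ_λ(x,y))_{λ+μ} z] + [y_μ φ_λ(x,z)]`. -/
structure IsConfBiderivation (D : R →ₗ[ℂ] R) (B : R → R → Pol1 R)
    (φ : R → R → Pol1 R) : Prop where
  bilin : IsConfBilinear D φ
  skew : IsSkew D φ
  leibniz : ∀ x y z,
    lift3 (fun r => ev (φ x r) Xl) (ev (B y z) Xm)
      = lift3 (fun r => ev (B r z) eLM) (ev (φ x y) Xl)
        + lift3 (fun r => ev (B y r) Xm) (ev (φ x z) Xl)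


/-- Coefficient finsupp of a polynomial. -/
noncomputable def toF {S : Type} [Semiring S] (p : Polynomial S) : ℕ →₀ S :=
  Finsupp.onFinset p.support (fun n => p.coeff n) (fun n h => Polynomial.mem_support_iff.mpr h)

/-- The loop `W(a,b)` conformal algebra
`CLW(a,b) = (⊕_{i∈ℤ} ℂ[∂]L_i) ⊕ (⊕_{i∈ℤ} ℂ[∂]G_i)` as a free `ℂ[∂]`-module; the basis
element indexed by `(false, i)` is `L_i` and the one indexed by `(true, i)` is `G_i`. -/
abbrev WR : Type := (Bool × ℤ) →₀ Polynomial ℂ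

/-- The action of `∂` on `CLW(a,b)`. -/
noncomputable def DW : WR →ₗ[ℂ] WR :=
  Finsupp.mapRange.linearMap (LinearMap.mulLeft ℂ (Polynomial.X : Polynomial ℂ))

/-- The basis element `L i`. -/
noncomputable def Lw (i : ℤ) : WR := Finsupp.single (false, i) (1 : Polynomial ℂ)

/-- The basis element `G i`. -/
noncomputable def Gw (i : ℤ) : WR := Finsupp.single (true, i) (1 : Polynomial ℂ)

/-- `ℂ → ℂ[∂][λ]` (constants). -/
noncomputable def cc : ℂ →+* Polynomial (Polynomial ℂ) := Polynomial.C.comp Polynomial.C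

/-- `∂` inside `ℂ[∂][λ]`. -/
noncomputable def vpd : Polynomial (Polynomial ℂ) := Polynomial.C Polynomial.X

/-- `λ` inside `ℂ[∂][λ]`. -/
noncomputable def vpl : Polynomial (Polynomial ℂ) := Polynomial.X

/-- The polynomial factor in the bracket of two basis elements:
`(∂+2λ)` for `[L,L]`, `(∂+(1-b)λ)` for `[L,G]`, `-(b∂+(b-1)λ)` for `[G,L]`,
and `0` for `[G,G]`. -/
noncomputable def wFactor (b : ℂ) : Bool → Bool → Polynomial (Polynomial ℂ)
  | false, false => vpd + 2 * vpl
  | false, true => vpd + cc (1 - b) * vpl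
  | true, false => -(cc b * vpd + cc (b - 1) * vpl)
  | true, true => 0

/-- The λ-bracket of `CLW(a,b)` (it depends only on `b`), determined by
`[L_i λ L_j] = (∂+2λ)L_{i+j}`, `[L_i λ G_j] = (∂+(1-b)λ)G_{i+j}`,
`[G_i λ L_j] = -(b∂+(b-1)λ)G_{i+j}`, `[G_i λ G_j] = 0`, and conformal sesquilinearity. -/
noncomputable def BW (b : ℂ) (f g : WR) : Pol1 WR :=
  f.sum fun s p => g.sum fun t q =>
    Finsupp.mapRange (fun c => Finsupp.single (s.1 || t.1, s.2 + t.2) c)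
      (Finsupp.single_zero _)
      (toF ((p.eval₂ cc (-vpl)) * (q.eval₂ cc (vpd + vpl)) * wFactor b s.1 t.1))

/-- The element `Σ_k a_{k-i-j} L_k` (if `s = false`) resp. `Σ_k a_{k-i-j} G_k`
(if `s = true`). -/
noncomputable def Sw (s : Bool) (a : ℤ →₀ ℂ) (i j : ℤ) : WR :=
  a.sum fun m c => Finsupp.single (s, m + i + j) (Polynomial.C c)

/-- `(∂+cλ)·x ∈ CLW(a,b)[λ]`. -/
noncomputable def dcl (c : ℂ) (x : WR) : Pol1 WR :=
  Finsupp.single 0 (DW x) + Finsupp.single 1 (c • x)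

section Specialization

variable {M : Type} [AddCommGroup M]

/-- The specialization `μ = γ = 0`, from `M[λ,μ,γ]` to `M[λ]`. -/
noncomputable def specl : Pol3 M →+ Pol1 M :=
  Finsupp.mapRange.addMonoidHom ((Finsupp.applyAddHom 0).comp (Finsupp.applyAddHom 0))

lemma specl_apply (w : Pol3 M) (n : ℕ) : specl w n = w n 0 0 := rfl

lemma mapDomain_succ_zero {N : Type} [AddCommMonoid N] (f : ℕ →₀ N) :
    Finsupp.mapDomain (· + 1) f 0 = 0 :=
  Finsupp.mapDomain_of_notMem_range _ _ (by simp)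

lemma mapDomain_succ_succ {N : Type} [AddCommMonoid N] (f : ℕ →₀ N) (n : ℕ) :
    Finsupp.mapDomain (· + 1) f (n + 1) = f n :=
  Finsupp.mapDomain_apply (add_left_injective 1) f n

lemma shift1_injective : Function.Injective (shift1 : Pol1 M → Pol1 M) :=
  Finsupp.mapDomain_injective (add_left_injective 1)

@[simp] lemma shift1_zero : shift1 (0 : Pol1 M) = 0 := Finsupp.mapDomain_zero

lemma shift1_iterate_zero (n : ℕ) : shift1^[n] (0 : Pol1 M) = 0 :=
  Function.iterate_fixed shift1_zero n

lemma shift1_iterate_single_zero (n : ℕ) (r : M) :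
    shift1^[n] (Finsupp.single 0 r) = Finsupp.single n r := by
  induction n with
  | zero => rfl
  | succ n ih => rw [Function.iterate_succ_apply', ih, shift1, Finsupp.mapDomain_single]

lemma specl_Xl (w : Pol3 M) : specl (Xl w) = shift1 (specl w) := by
  ext n
  cases n with
  | zero => simp [specl_apply, Xl, shift1, mapDomain_succ_zero]
  | succ n => simp [specl_apply, Xl, shift1, mapDomain_succ_succ]

lemma specl_Xm (w : Pol3 M) : specl (Xm w) = 0 := by
  ext n
  simp [specl_apply, Xm, mapDomain_succ_zero]

lemma specl_Xg (w : Pol3 M) : specl (Xg w) = 0 := by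
  ext n
  simp [specl_apply, Xg, mapDomain_succ_zero]

lemma specl_eLM (w : Pol3 M) : specl (eLM w) = shift1 (specl w) := by
  rw [eLM, map_add, specl_Xl, specl_Xm, add_zero]

lemma specl_iota3 (r : M) : specl (iota3 r) = Finsupp.single 0 r := by
  simp [specl, iota3]

lemma specl_iterate {e : Pol3 M → Pol3 M} (he : ∀ w, specl (e w) = shift1 (specl w))
    (n : ℕ) (w : Pol3 M) : specl (e^[n] w) = shift1^[n] (specl w) :=
  (Function.Semiconj.iterate_right he n) w

lemma specl_ev {e : Pol3 M → Pol3 M} (he : ∀ w, specl (e w) = shift1 (specl w))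
    (f : Pol1 M) : specl (ev f e) = f := by
  rw [ev, map_finsuppSum]
  simp_rw [specl_iterate he, specl_iota3, shift1_iterate_single_zero]
  exact Finsupp.sum_single f

lemma specl_ev_Xm (f : Pol1 M) : specl (ev f Xm) = Finsupp.single 0 (f 0) := by
  rw [ev, map_finsuppSum, Finsupp.sum, Finset.sum_eq_single 0]
  · exact specl_iota3 _
  · intro n _ hn
    obtain ⟨m, rfl⟩ := Nat.exists_eq_succ_of_ne_zero hn
    rw [Function.iterate_succ_apply', specl_Xm]
  · intro h
    simp [Finsupp.notMem_support_iff.mp h, specl_iota3]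

lemma specl_lift3 (F : M → Pol3 M) (hF : specl (F 0) = 0) (w : Pol3 M) :
    specl (lift3 F w) = (specl w).sum fun a r => shift1^[a] (specl (F r)) := by
  have hterm : ∀ a b c r, specl (Xl^[a] (Xm^[b] (Xg^[c] (F r)))) =
      if b = 0 ∧ c = 0 then shift1^[a] (specl (F r)) else 0 := by
    intro a b c r
    rw [specl_iterate specl_Xl]
    rcases b with _ | b
    · rcases c with _ | c
      · simp
      · simp [Function.iterate_succ_apply', specl_Xg, shift1_iterate_zero, -Function.iterate_succ]
    · simp [Function.iterate_succ_apply', specl_Xm, shift1_iterate_zero, -Function.iterate_succ]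
  have hin : ∀ (a : ℕ) (fa : ℕ →₀ ℕ →₀ M),
      (fa.sum fun b fb => fb.sum fun c r =>
        if b = 0 ∧ c = 0 then shift1^[a] (specl (F r)) else 0)
        = shift1^[a] (specl (F (fa 0 0))) := by
    intro a fa
    rw [Finsupp.sum, Finset.sum_eq_single 0]
    · rw [Finsupp.sum, Finset.sum_eq_single 0]
      · simp
      · intro c _ hc
        simp [hc]
      · intro h
        simp [Finsupp.notMem_support_iff.mp h, hF, shift1_iterate_zero]
    · intro b _ hb
      simp [hb]
    · intro h
      simp [Finsupp.notMem_support_iff.mp h]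
  rw [lift3, map_finsuppSum]
  simp_rw [map_finsuppSum, hterm, hin]
  symm
  refine Finsupp.sum_of_support_subset _ ?_ _ ?_
  · intro n hn
    rw [Finsupp.mem_support_iff] at hn ⊢
    contrapose! hn
    simp [specl_apply, hn]
  · simp [hF, shift1_iterate_zero]

end Specialization

lemma IsConfBilinear.zero_left {D : R →ₗ[ℂ] R}
    {φ : R → R → Pol1 R} (h : IsConfBilinear D φ) (y : R) : φ 0 y = 0 := by
  simpa using h.smul_left 0 0 y

lemma IsConfBilinear.zero_right {D : R →ₗ[ℂ] R}
    {φ : R → R → Pol1 R} (h : IsConfBilinear D φ) (x : R) : φ x 0 = 0 := by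
  simpa using h.smul_right 0 x 0

/-- If `[y_0 r] = ∂r` for all `r`, then `λ φ_λ(x,z) = [φ_λ(x,y)_λ z]`. -/
lemma IsConfBiderivation.shift1_eq {D : R →ₗ[ℂ] R}
    {B φ : R → R → Pol1 R} (h : IsConfBiderivation D B φ) {y : R} (hy : ∀ r, B y r 0 = D r)
    (hB : ∀ z, B 0 z = 0) (x z : R) :
    shift1 (φ x z) = (φ x y).sum fun a r => shift1^[a] (B r z) := by
  have key := congrArg specl (h.leibniz x y z)
  have hφ0 := h.bilin.zero_right x
  rw [map_add, specl_lift3, specl_lift3, specl_lift3] at key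
  · simp_rw [specl_ev specl_Xl, specl_ev specl_eLM, specl_ev_Xm, hy,
      shift1_iterate_single_zero] at key
    rw [Finsupp.sum_single_index (by simpa using hφ0), Function.iterate_zero_apply,
      h.bilin.d_right] at key
    have hD : ((φ x z).sum fun a r => Finsupp.single a (D r)) = D1 D (φ x z) := by
      have := Finsupp.sum_mapRange_index (f := D) (hf := map_zero D) (g := φ x z)
        (h := fun a r => Finsupp.single a r) (by simp)
      rw [← this]
      exact Finsupp.sum_single _
    rw [hD, add_comm] at key
    exact add_right_cancel key
  · rw [specl_ev_Xm, hy, map_zero, Finsupp.single_zero]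
  · rw [hB]; simp [ev]
  · rw [hφ0]; simp [ev]

/-- The subgroup `⊕ ℂ[∂]G_i` of `CLW(a,b)`. -/
def gSub : AddSubgroup WR where
  carrier := {r | ∀ k, r (false, k) = 0}
  add_mem' hx hy k := by simp [hx k, hy k]
  zero_mem' _ := rfl
  neg_mem' hx k := by simp [hx k]

/-- Polynomials in `λ` with coefficients in `⊕ ℂ[∂]G_i`. -/
def gPol : AddSubgroup (Pol1 WR) where
  carrier := {f | ∀ n, f n ∈ gSub}
  add_mem' hx hy n := gSub.add_mem (hx n) (hy n)
  zero_mem' _ := gSub.zero_mem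
  neg_mem' hx n := gSub.neg_mem (hx n)

lemma DW_mem_gSub {r : WR} (h : r ∈ gSub) : DW r ∈ gSub := fun k => by
  simp [DW, h k]

lemma shift1_mem_gPol {f : Pol1 WR} : shift1 f ∈ gPol ↔ f ∈ gPol := by
  refine ⟨fun h n => ?_, fun h n => ?_⟩
  · simpa [shift1, mapDomain_succ_succ] using h (n + 1)
  · cases n with
    | zero => simp [shift1, mapDomain_succ_zero]
    | succ n => simpa [shift1, mapDomain_succ_succ] using h n

lemma subNeg_mem_gPol {f : Pol1 WR} (h : f ∈ gPol) : subNeg DW f ∈ gPol :=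
  gPol.sub_mem (gPol.neg_mem fun n => DW_mem_gSub (h n)) (shift1_mem_gPol.mpr h)

lemma iterate_mem_gPol {e : Pol1 WR → Pol1 WR} (he : ∀ f ∈ gPol, e f ∈ gPol) (n : ℕ)
    {f : Pol1 WR} (h : f ∈ gPol) : e^[n] f ∈ gPol := by
  induction n with
  | zero => exact h
  | succ n ih => rw [Function.iterate_succ_apply']; exact he _ ih

lemma single_mem_gPol (n : ℕ) {r : WR} (h : r ∈ gSub) : Finsupp.single n r ∈ gPol := by
  intro m
  rw [Finsupp.single_apply]
  split_ifs
  exacts [h, gSub.zero_mem]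

lemma ev1_subNeg_mem_gPol {f : Pol1 WR} (h : f ∈ gPol) : ev1 f (subNeg DW) ∈ gPol :=
  gPol.sum_mem fun n _ =>
    iterate_mem_gPol (fun _ => subNeg_mem_gPol) n (single_mem_gPol 0 (h n))

lemma BW_zero_left (b : ℂ) (z : WR) : BW b 0 z = 0 := Finsupp.sum_zero_index

lemma toF_zero {S : Type} [Semiring S] : toF (0 : Polynomial S) = 0 := by
  ext; simp [toF]

lemma toF_apply {S : Type} [Semiring S] (p : Polynomial S) (n : ℕ) : toF p n = p.coeff n := rfl

lemma BW_Gw (b : ℂ) (r : WR) (j : ℤ) :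
    BW b r (Gw j) = r.sum fun s p =>
      Finsupp.mapRange (fun c => Finsupp.single (true, s.2 + j) c) (Finsupp.single_zero _)
        (toF ((p.eval₂ cc (-vpl)) * wFactor b s.1 true)) := by
  simp only [BW, Gw]
  refine Finsupp.sum_congr fun s _ => ?_
  rw [Finsupp.sum_single_index (by simp [toF_zero])]
  simp

lemma BW_Gw_mem_gPol (b : ℂ) (r : WR) (j : ℤ) : BW b r (Gw j) ∈ gPol := by
  rw [BW_Gw]
  refine gPol.sum_mem fun s _ n k => ?_
  simp

lemma BW_Gw_eq_zero (b : ℂ) {r : WR} (hr : r ∈ gSub) (j : ℤ) : BW b r (Gw j) = 0 := by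
  rw [BW_Gw]
  refine Finset.sum_eq_zero fun s hs => ?_
  obtain ⟨_ | _, k⟩ := s
  · exact absurd (hr k) (Finsupp.mem_support_iff.mp hs)
  · simp [wFactor, toF_zero]

lemma coeff_zero_eval₂_cc (q : Polynomial ℂ) : (q.eval₂ cc (vpd + vpl)).coeff 0 = q := by
  rw [← Polynomial.constantCoeff_apply, Polynomial.hom_eval₂]
  have hc : Polynomial.constantCoeff.comp cc = Polynomial.C := by
    ext; simp [cc]
  have hv : Polynomial.constantCoeff (vpd + vpl) = Polynomial.X := by
    simp [vpd, vpl]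
  rw [hc, hv, Polynomial.eval₂_C_X]

lemma coeff_zero_wFactor_false (b : ℂ) (s : Bool) :
    (wFactor b false s).coeff 0 = Polynomial.X := by
  cases s <;> simp [wFactor, vpd, vpl]

lemma BW_Lw_zero (b : ℂ) (r : WR) : BW b (Lw 0) r 0 = DW r := by
  rw [BW, Lw, Finsupp.sum_single_index (by simp [toF_zero]), Finsupp.sum, Finsupp.finsetSum_apply]
  simp only [Finsupp.mapRange_apply, toF_apply, Polynomial.mul_coeff_zero, coeff_zero_eval₂_cc,
    coeff_zero_wFactor_false, Polynomial.eval₂_one, one_mul,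
    Bool.false_or, zero_add, Prod.mk.eta]
  conv_rhs => rw [← Finsupp.sum_single r, Finsupp.sum, map_sum]
  refine Finset.sum_congr rfl fun t _ => ?_
  simp [DW, mul_comm]

/-- if `φ` is a conformal biderivation of the loop `W(a,b)` Lie conformal
algebra `CLW(a,b)`, then `φ_λ(G_i, G_j) = 0` for all `i, j ∈ ℤ`. -/
theorem clw_biderivation_GG (a b : ℂ) (φ : WR → WR → Pol1 WR)
    (hφ : IsConfBiderivation DW (BW b) φ) :
    ∀ i j : ℤ, φ (Gw i) (Gw j) = 0 := by
  intro i j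
  have key := hφ.shift1_eq (BW_Lw_zero b) (BW_zero_left b)
  have hLG : φ (Lw 0) (Gw i) ∈ gPol := by
    rw [← shift1_mem_gPol, key]
    exact gPol.sum_mem fun n _ =>
      iterate_mem_gPol (fun _ => shift1_mem_gPol.mpr) n (BW_Gw_mem_gPol b _ i)
  have hGL : φ (Gw i) (Lw 0) ∈ gPol := by
    rw [hφ.skew]
    exact gPol.neg_mem (ev1_subNeg_mem_gPol hLG)
  apply shift1_injective
  rw [key, shift1_zero]
  refine Finset.sum_eq_zero fun n _ => ?_
  simp only [BW_Gw_eq_zero b (hGL n) j, shift1_iterate_zero]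

end ConfBider
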